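/- arXiv:2104.13788 — 6 statements merged into one kernel-verified Lean document; each statement's English description precedes it below -/
import Mathlib

section
/- Let P be a set, F = F(P) the free abelian monoid over P, and H ⊆ F a submonoid such that the inclusion H ↪ F is a divisor homomorphism. If x, y ∈ F are irrelevant, then x + y is irrelevant. -/
/-- The canonical embedding of the free abelian monoid `F(P)` into its quotient group
`q(F)`, i.e. of `P →₀ ℕ` into `P →₀ ℤ`. -/
noncomputable def toIntF {P : Type*} : (P →₀ ℕ) →+ (P →₀ ℤ) :=
  Finsupp.mapRange.addMonoidHom (Nat.castAddMonoidHom ℤ)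

/-- The inclusion `H ↪ F(P)` is a divisor homomorphism. -/
def IsDivHomF {P : Type*} (H : AddSubmonoid (P →₀ ℕ)) : Prop :=
  ∀ a ∈ H, ∀ b ∈ H, a ≤ b → b - a ∈ H

/-- The inclusion `H ↪ F(P)` is cofinal. -/
def IsCofinalF {P : Type*} (H : AddSubmonoid (P →₀ ℕ)) : Prop :=
  ∀ x : P →₀ ℕ, ∃ h ∈ H, x ≤ h

/-- The inclusion `H ↪ F(P)` is a divisor theory: a divisor homomorphism such that every
`p ∈ P` is the pointwise infimum of a finite nonempty subset of `H`. -/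
def IsDivTheoryF {P : Type*} (H : AddSubmonoid (P →₀ ℕ)) : Prop :=
  IsDivHomF H ∧ ∀ p : P, ∃ (X : Finset (P →₀ ℕ)) (hX : X.Nonempty),
    (X : Set (P →₀ ℕ)) ⊆ (H : Set (P →₀ ℕ)) ∧
      ∀ q : P, X.inf' hX (fun h => h q) = Finsupp.single p 1 q

/-- The quotient group `q(H)` of `H`, as a subgroup of `q(F) = (P →₀ ℤ)`. -/
noncomputable def qHsub {P : Type*} (H : AddSubmonoid (P →₀ ℕ)) : AddSubgroup (P →₀ ℤ) :=
  AddSubgroup.closure (⇑toIntF '' (H : Set (P →₀ ℕ)))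

/-- The class group `G = q(F)/q(H)` of the inclusion `H ↪ F(P)`. -/
abbrev ClassGrp {P : Type*} (H : AddSubmonoid (P →₀ ℕ)) : Type _ :=
  (P →₀ ℤ) ⧸ qHsub H

/-- The canonical projection `q(F) → G`, `x ↦ [x]`. -/
noncomputable def clsOf {P : Type*} (H : AddSubmonoid (P →₀ ℕ)) : (P →₀ ℤ) →+ ClassGrp H :=
  QuotientAddGroup.mk' (qHsub H)

/-- The set `G_P = {[p] : p ∈ P}` of classes containing prime divisors. -/
def GPset {P : Type*} (H : AddSubmonoid (P →₀ ℕ)) : Set (ClassGrp H) :=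
  {g | ∃ p : P, g = clsOf H (Finsupp.single p 1)}

/-- The image of `H` inside `q(F) = (P →₀ ℤ)`. -/
noncomputable def Hset {P : Type*} (H : AddSubmonoid (P →₀ ℕ)) : Set (P →₀ ℤ) :=
  ⇑toIntF '' (H : Set (P →₀ ℕ))

/-- The colon construction `(A : B) = {x ∈ q(H) : x + b ∈ A for all b ∈ B}`. -/
def colonSet {P : Type*} (H : AddSubmonoid (P →₀ ℕ)) (A B : Set (P →₀ ℤ)) : Set (P →₀ ℤ) :=
  {x | x ∈ qHsub H ∧ ∀ b ∈ B, x + b ∈ A}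

/-- `A⁻¹ = (H : A)`. -/
noncomputable def invSet {P : Type*} (H : AddSubmonoid (P →₀ ℕ)) (A : Set (P →₀ ℤ)) :
    Set (P →₀ ℤ) :=
  colonSet H (Hset H) A

/-- The `v`-closure `A_v = (A⁻¹)⁻¹`. -/
noncomputable def vClos {P : Type*} (H : AddSubmonoid (P →₀ ℕ)) (A : Set (P →₀ ℤ)) :
    Set (P →₀ ℤ) :=
  invSet H (invSet H A)

/-- For `x ∈ F`, the set `xF ∩ H = {h ∈ H : x ≤ h}`. -/
def divIdeal {P : Type*} (H : AddSubmonoid (P →₀ ℕ)) (x : P →₀ ℕ) : Set (P →₀ ℕ) :=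
  {h | h ∈ H ∧ x ≤ h}

/-- An element `x ∈ F` is irrelevant if `(xF ∩ H)_v = H`. -/
noncomputable def Irrelevant {P : Type*} (H : AddSubmonoid (P →₀ ℕ)) (x : P →₀ ℕ) : Prop :=
  vClos H (⇑toIntF '' divIdeal H x) = Hset H

theorem irrelevant_iff_aux {P : Type*} (H : AddSubmonoid (P →₀ ℕ)) (x : P →₀ ℕ) :
    Irrelevant H x ↔ ∀ z ∈ invSet H (⇑toIntF '' divIdeal H x), z ∈ Hset H := by
  constructor
  · intro h z hz
    have h0 : (0 : P →₀ ℤ) ∈ vClos H (⇑toIntF '' divIdeal H x) := by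
      rw [h]
      exact ⟨0, H.zero_mem, map_zero _⟩
    simpa using h0.2 z hz
  · intro h
    apply Set.Subset.antisymm
    · intro w hw
      have h0 : (0 : P →₀ ℤ) ∈ invSet H (⇑toIntF '' divIdeal H x) := by
        refine ⟨AddSubgroup.zero_mem _, ?_⟩
        rintro _ ⟨b, hb, rfl⟩
        rw [zero_add]
        exact ⟨b, hb.1, rfl⟩
      simpa using hw.2 0 h0
    · intro w hw
      refine ⟨AddSubgroup.subset_closure hw, ?_⟩
      intro z hz
      obtain ⟨a, ha, rfl⟩ := hw
      obtain ⟨b, hb, rfl⟩ := h z hz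
      exact ⟨a + b, H.add_mem ha hb, map_add _ _ _⟩

/-- If `H ↪ F(P)` is a divisor homomorphism and `x, y ∈ F` are
irrelevant, then `x + y` is irrelevant. -/
theorem irrelevant_add {P : Type*} (H : AddSubmonoid (P →₀ ℕ)) (hdiv : IsDivHomF H)
    (x y : P →₀ ℕ) (hx : Irrelevant H x) (hy : Irrelevant H y) :
    Irrelevant H (x + y) := by
  rw [irrelevant_iff_aux] at hx hy ⊢
  intro z hz
  apply hx
  refine ⟨hz.1, ?_⟩
  rintro _ ⟨a, ha, rfl⟩
  apply hy
  refine ⟨AddSubgroup.add_mem _ hz.1 (AddSubgroup.subset_closure ⟨a, ha.1, rfl⟩), ?_⟩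
  rintro _ ⟨b, hb, rfl⟩
  rw [add_assoc, ← map_add]
  exact hz.2 _ ⟨a + b, ⟨H.add_mem ha.1 hb.1, add_le_add ha.2 hb.2⟩, rfl⟩
end

section
/- Let P be a set, F = F(P) the free abelian monoid over P, and H ⊆ F a submonoid such that the inclusion H ↪ F is a divisor homomorphism. Let p ∈ P be not irrelevant and suppose pF ∩ H = {h ∈ H : h(p) ≥ 1} is nonempty. Then pF ∩ H is a minimal nonempty prime s-ideal of H, i.e., pF ∩ H ∈ 𝔛(H), and (pF ∩ H)_v = pF ∩ H. -/
/-- An `s`-ideal of `H`: a subset `𝔞 ⊆ H` with `𝔞 + H ⊆ 𝔞`. -/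
def IsSIdeal {P : Type*} (H : AddSubmonoid (P →₀ ℕ)) (a : Set (P →₀ ℕ)) : Prop :=
  a ⊆ (H : Set (P →₀ ℕ)) ∧ ∀ x ∈ a, ∀ h ∈ H, x + h ∈ a

/-- A prime `s`-ideal of `H`. -/
def IsPrimeSIdeal {P : Type*} (H : AddSubmonoid (P →₀ ℕ)) (a : Set (P →₀ ℕ)) : Prop :=
  IsSIdeal H a ∧ a ≠ (H : Set (P →₀ ℕ)) ∧
    ∀ x ∈ H, ∀ y ∈ H, x + y ∈ a → x ∈ a ∨ y ∈ a

/-- `𝔛(H)`: the set of minimal nonempty prime `s`-ideals of `H`. -/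
def XH {P : Type*} (H : AddSubmonoid (P →₀ ℕ)) : Set (Set (P →₀ ℕ)) :=
  {q | q.Nonempty ∧ IsPrimeSIdeal H q ∧
    ∀ q' : Set (P →₀ ℕ), q'.Nonempty → IsPrimeSIdeal H q' → q' ⊆ q → q' = q}

/-- For `p ∈ P`, the set `pF ∩ H = {h ∈ H : h(p) ≥ 1}`. -/
def pIdeal {P : Type*} (H : AddSubmonoid (P →₀ ℕ)) (p : P) : Set (P →₀ ℕ) :=
  {h | h ∈ H ∧ 1 ≤ h p}

theorem toIntF_app {P : Type*} (a : P →₀ ℕ) (q : P) : toIntF a q = (a q : ℤ) := by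
  simp [toIntF]

theorem toIntF_inj' {P : Type*} {a b : P →₀ ℕ} (h : toIntF a = toIntF b) : a = b := by
  ext q
  have := DFunLike.congr_fun h q
  rw [toIntF_app, toIntF_app] at this
  exact_mod_cast this

theorem mem_qH_iff {P : Type*} (H : AddSubmonoid (P →₀ ℕ)) (x : P →₀ ℤ) (hx : x ∈ qHsub H) :
    ∃ a ∈ H, ∃ b ∈ H, x = toIntF a - toIntF b := by
  unfold qHsub at hx
  induction hx using AddSubgroup.closure_induction with
  | mem x hx =>
    obtain ⟨a, ha, rfl⟩ := hx
    exact ⟨a, ha, 0, H.zero_mem, by simp⟩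
  | zero => exact ⟨0, H.zero_mem, 0, H.zero_mem, by simp⟩
  | add x y _ _ ihx ihy =>
    obtain ⟨a, ha, b, hb, rfl⟩ := ihx
    obtain ⟨c, hc, d, hd, rfl⟩ := ihy
    exact ⟨a + c, H.add_mem ha hc, b + d, H.add_mem hb hd, by rw [map_add, map_add]; abel⟩
  | neg x _ ih =>
    obtain ⟨a, ha, b, hb, rfl⟩ := ih
    exact ⟨b, hb, a, ha, by abel⟩

theorem mem_Hset_of_nonneg {P : Type*} (H : AddSubmonoid (P →₀ ℕ)) (hdiv : IsDivHomF H)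
    (x : P →₀ ℤ) (hx : x ∈ qHsub H) (h0 : ∀ q, 0 ≤ x q) : x ∈ Hset H := by
  obtain ⟨a, ha, b, hb, rfl⟩ := mem_qH_iff H x hx
  have hle : b ≤ a := by
    intro q
    have := h0 q
    rw [Finsupp.sub_apply, toIntF_app, toIntF_app] at this
    omega
  refine ⟨a - b, hdiv b hb a ha hle, ?_⟩
  ext q
  have := hle q
  rw [Finsupp.sub_apply, toIntF_app, toIntF_app, toIntF_app, Finsupp.tsub_apply]
  omega

theorem Hset_sub_qH {P : Type*} (H : AddSubmonoid (P →₀ ℕ)) : Hset H ⊆ qHsub H :=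
  AddSubgroup.subset_closure

theorem Hset_add {P : Type*} (H : AddSubmonoid (P →₀ ℕ)) {x y : P →₀ ℤ}
    (hx : x ∈ Hset H) (hy : y ∈ Hset H) : x + y ∈ Hset H := by
  obtain ⟨a, ha, rfl⟩ := hx
  obtain ⟨b, hb, rfl⟩ := hy
  exact ⟨a + b, H.add_mem ha hb, map_add _ _ _⟩

theorem Hset_zero {P : Type*} (H : AddSubmonoid (P →₀ ℕ)) : (0 : P →₀ ℤ) ∈ Hset H :=
  ⟨0, H.zero_mem, map_zero _⟩

theorem Hset_sub_inv {P : Type*} (H : AddSubmonoid (P →₀ ℕ)) (p : P) :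
    Hset H ⊆ invSet H (⇑toIntF '' pIdeal H p) := by
  intro x hx
  refine ⟨Hset_sub_qH H hx, ?_⟩
  rintro _ ⟨a, ha, rfl⟩
  exact Hset_add H hx ⟨a, ha.1, rfl⟩

theorem vClos_sub_Hset {P : Type*} (H : AddSubmonoid (P →₀ ℕ)) (p : P) :
    vClos H (⇑toIntF '' pIdeal H p) ⊆ Hset H := by
  intro y hy
  simpa using hy.2 0 (Hset_sub_inv H p (Hset_zero H))

theorem divIdeal_single {P : Type*} (H : AddSubmonoid (P →₀ ℕ)) (p : P) :
    divIdeal H (Finsupp.single p 1) = pIdeal H p := by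
  ext h
  simp [divIdeal, pIdeal, Finsupp.single_le_iff]

theorem exists_wit {P : Type*} (H : AddSubmonoid (P →₀ ℕ))
    (hdiv : IsDivHomF H) (p : P) (hp : ¬ Irrelevant H (Finsupp.single p 1))
    (hne : (pIdeal H p).Nonempty) :
    ∃ x ∈ invSet H (⇑toIntF '' pIdeal H p), x p < 0 := by
  by_contra! hcon
  apply hp
  unfold Irrelevant
  rw [divIdeal_single]
  have key : invSet H (⇑toIntF '' pIdeal H p) ⊆ Hset H := by
    intro x hx
    refine mem_Hset_of_nonneg H hdiv x hx.1 ?_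
    obtain ⟨a, ha⟩ := hne
    have hxp := hcon x hx
    have step : ∀ n : ℕ, ∃ b ∈ pIdeal H p, toIntF b = toIntF a + n • x := by
      intro n
      induction n with
      | zero => exact ⟨a, ha, by simp⟩
      | succ n ih =>
        obtain ⟨b, hb, hbe⟩ := ih
        obtain ⟨c, hc, hce⟩ := hx.2 _ ⟨b, hb, rfl⟩
        refine ⟨c, ⟨hc, ?_⟩, ?_⟩
        · have := DFunLike.congr_fun hce p
          rw [Finsupp.add_apply, toIntF_app, toIntF_app] at this
          have := hb.2
          omega
        · rw [hce, hbe, succ_nsmul]; abel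
    intro q
    by_contra! hq
    obtain ⟨b, hb, hbe⟩ := step (a q + 1)
    have := DFunLike.congr_fun hbe q
    rw [Finsupp.add_apply, toIntF_app, toIntF_app, Finsupp.smul_apply, nsmul_eq_mul] at this
    push_cast at this
    nlinarith
  apply Set.Subset.antisymm (vClos_sub_Hset H p)
  intro y hy
  exact ⟨Hset_sub_qH H hy, fun b hb => Hset_add H hy (key hb)⟩

theorem descend {P : Type*} (H : AddSubmonoid (P →₀ ℕ)) (p : P) (x : P →₀ ℤ)
    (hx : x ∈ invSet H (⇑toIntF '' pIdeal H p)) (hxp : x p < 0) (N : ℕ) :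
    ∀ a ∈ H, a p ≤ N → ∃ n : ℕ, ∃ d ∈ H, d p = 0 ∧ toIntF d = toIntF a + n • x := by
  induction N with
  | zero => exact fun a ha h => ⟨0, a, ha, by omega, by simp⟩
  | succ N ih =>
    intro a ha h
    by_cases h0 : a p = 0
    · exact ⟨0, a, ha, h0, by simp⟩
    obtain ⟨c, hc, hce⟩ := hx.2 _ ⟨a, ⟨ha, by omega⟩, rfl⟩
    have := DFunLike.congr_fun hce p
    rw [Finsupp.add_apply, toIntF_app, toIntF_app] at this
    obtain ⟨n, d, hd, hd0, hde⟩ := ih c hc (by omega)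
    exact ⟨n + 1, d, hd, hd0, by rw [hde, hce, succ_nsmul]; abel⟩

/-- Let `H ↪ F(P)` be a divisor homomorphism and `p ∈ P` be not
irrelevant with `pF ∩ H = {h ∈ H : h(p) ≥ 1}` nonempty. Then `pF ∩ H ∈ 𝔛(H)` and
`(pF ∩ H)_v = pF ∩ H`. -/
theorem pIdeal_mem_XH_of_not_irrelevant {P : Type*} (H : AddSubmonoid (P →₀ ℕ))
    (hdiv : IsDivHomF H) (p : P) (hp : ¬ Irrelevant H (Finsupp.single p 1))
    (hne : (pIdeal H p).Nonempty) :
    pIdeal H p ∈ XH H ∧ vClos H (⇑toIntF '' pIdeal H p) = ⇑toIntF '' pIdeal H p := by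
  obtain ⟨x, hx, hxp⟩ := exists_wit H hdiv p hp hne
  refine ⟨⟨hne, ⟨⟨fun h hh => hh.1, ?_⟩, ?_, ?_⟩, ?_⟩, ?_⟩
  · intro a ha h hh
    refine ⟨H.add_mem ha.1 hh, ?_⟩
    have := ha.2
    rw [Finsupp.add_apply]; omega
  · intro h
    have h0 : (0 : P →₀ ℕ) ∈ pIdeal H p := by rw [h]; exact H.zero_mem
    have := h0.2
    simp at this
  · intro a ha b hb hab
    have := hab.2
    rw [Finsupp.add_apply] at this
    by_cases h : 1 ≤ a p
    · exact Or.inl ⟨ha, h⟩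
    · exact Or.inr ⟨hb, by omega⟩
  · intro q' hq' hprime hsub
    refine Set.Subset.antisymm hsub ?_
    obtain ⟨⟨hqH, hqadd⟩, -, hpr⟩ := hprime
    have pw : ∀ y ∈ H, ∀ k : ℕ, k • y ∈ q' → y ∈ q' := by
      intro y hy k
      induction k with
      | zero =>
        intro h
        have := (hsub h).2
        simp at this
      | succ k ih =>
        intro h
        rw [succ_nsmul] at h
        rcases hpr _ (H.nsmul_mem hy k) _ hy h with h | h
        · exact ih h
        · exact h
    obtain ⟨a, ha⟩ := hq'
    intro b hb
    obtain ⟨m, d, hd, hd0, hde⟩ := descend H p x hx hxp _ a (hqH ha) le_rfl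
    obtain ⟨n, c, hc, hc0, hce⟩ := descend H p x hx hxp _ b hb.1 le_rfl
    have hn : n ≠ 0 := by
      rintro rfl
      rw [zero_nsmul, add_zero] at hce
      have := toIntF_inj' hce
      have := hb.2
      simp_all
    obtain ⟨k, rfl⟩ := Nat.exists_eq_succ_of_ne_zero hn
    have e : (k + 1) • d + m • b = a + (k • a + m • c) := by
      apply toIntF_inj'
      simp only [map_add, map_nsmul, hde, hce]
      simp only [Nat.succ_eq_add_one, nsmul_add, smul_smul, add_smul, mul_add, add_mul, one_smul,
        mul_one, one_mul, mul_comm k m]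
      abel
    have h1 : (k + 1) • d + m • b ∈ q' := by
      rw [e]
      exact hqadd a ha _ (H.add_mem (H.nsmul_mem (hqH ha) _) (H.nsmul_mem hc _))
    rcases hpr _ (H.nsmul_mem hd _) _ (H.nsmul_mem hb.1 _) h1 with h | h
    · have := (hsub (pw d hd _ h)).2
      omega
    · exact pw b hb.1 _ h
  · apply Set.Subset.antisymm
    · intro y hy
      obtain ⟨h, hh, rfl⟩ := vClos_sub_Hset H p hy
      refine ⟨h, ⟨hh, ?_⟩, rfl⟩
      obtain ⟨c, hc, hce⟩ := hy.2 x hx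
      have := DFunLike.congr_fun hce p
      rw [Finsupp.add_apply, toIntF_app, toIntF_app] at this
      omega
    · intro y hy
      refine ⟨?_, fun b hb => ?_⟩
      · obtain ⟨a, ha, rfl⟩ := hy
        exact Hset_sub_qH H ⟨a, ha.1, rfl⟩
      · rw [add_comm]
        exact hb.2 y hy
end

section
/- Let P be a set, F = F(P) the free abelian monoid over P, and H ⊆ F a submonoid such that the inclusion H ↪ F is a divisor homomorphism. Then for every q ∈ 𝔛(H) there exists p ∈ P such that q = pF ∩ H = {h ∈ H : h(p) ≥ 1}. -/
/-- If `H ↪ F(P)` is a divisor homomorphism, then every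
`q ∈ 𝔛(H)` is of the form `q = pF ∩ H = {h ∈ H : h(p) ≥ 1}` for some `p ∈ P`. -/
theorem XH_eq_pIdeal {P : Type*} (H : AddSubmonoid (P →₀ ℕ)) (hdiv : IsDivHomF H) :
    ∀ q ∈ XH H, ∃ p : P, q = pIdeal H p := by
  rintro q ⟨⟨a, ha⟩, ⟨⟨hqH, hqadd⟩, hne, hprime⟩, hmin⟩
  have h0 : (0 : P →₀ ℕ) ∉ q := by
    intro h0
    apply hne
    apply Set.Subset.antisymm hqH
    intro h hh
    simpa using hqadd 0 h0 h hh
  let C : AddSubmonoid (P →₀ ℕ) :=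
    { carrier := {h | h ∈ H ∧ h ∉ q}
      zero_mem' := ⟨H.zero_mem, h0⟩
      add_mem' := by
        rintro x y ⟨hx, hxq⟩ ⟨hy, hyq⟩
        exact ⟨H.add_mem hx hy, fun h => (hprime x hx y hy h).elim hxq hyq⟩ }
  have key : ∃ p ∈ a.support, pIdeal H p ⊆ q := by
    by_contra hcon
    have hex : ∀ p : P, ∃ h ∈ C, p ∈ a.support → 1 ≤ h p := by
      intro p
      by_cases hp : p ∈ a.support
      · have h1 : ¬ pIdeal H p ⊆ q := fun h => hcon ⟨p, hp, h⟩
        obtain ⟨h, hh, hhq⟩ := Set.not_subset.mp h1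
        exact ⟨h, ⟨hh.1, hhq⟩, fun _ => hh.2⟩
      · exact ⟨0, C.zero_mem, fun h => absurd h hp⟩
    choose f hf hfp using hex
    have hs : (∑ p ∈ a.support, a p • f p) ∈ C :=
      C.sum_mem fun p _ => C.nsmul_mem (hf p) _
    have hle : a ≤ ∑ p ∈ a.support, a p • f p := by
      intro p
      by_cases hp : p ∈ a.support
      · rw [Finsupp.finsetSum_apply]
        calc a p ≤ (a p • f p) p := by
              have := hfp p hp
              simpa using Nat.le_mul_of_pos_right (a p) this
          _ ≤ _ := Finset.single_le_sum (f := fun i => (a i • f i) p)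
              (fun i _ => Nat.zero_le _) hp
      · rw [Finsupp.notMem_support_iff.mp hp]
        exact Nat.zero_le _
    apply hs.2
    have := hqadd a ha _ (hdiv a (hqH ha) _ hs.1 hle)
    rwa [add_tsub_cancel_of_le hle] at this
  obtain ⟨p, hp, hsub⟩ := key
  refine ⟨p, (hmin (pIdeal H p) ⟨a, hqH ha, Nat.one_le_iff_ne_zero.mpr (Finsupp.mem_support_iff.mp hp)⟩
    ⟨⟨fun h hh => hh.1, ?_⟩, ?_, ?_⟩ hsub).symm⟩
  · rintro x ⟨hx, hxp⟩ h hh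
    refine ⟨H.add_mem hx hh, ?_⟩
    rw [Finsupp.add_apply]
    omega
  · intro h
    have : (0 : P →₀ ℕ) ∈ pIdeal H p := by
      rw [h]
      exact H.zero_mem
    simpa using this.2
  · rintro x hx y hy ⟨_, hxy⟩
    rw [Finsupp.add_apply] at hxy
    by_cases h : 1 ≤ x p
    · exact Or.inl ⟨hx, h⟩
    · exact Or.inr ⟨hy, by omega⟩
end

section
/- Let P be a set, F = F(P) the free abelian monoid over P, and H ⊆ F a submonoid such that the inclusion H ↪ F is a divisor homomorphism. Let p ∈ P be such that q = pF ∩ H = {h ∈ H : h(p) ≥ 1} belongs to 𝔛(H), and set e = min{h(p) : h ∈ H, h(p) > 0}. Then {h(p) : h ∈ H} = {e·n : n ∈ ℕ₀}; in particular e = gcd{h(p) : h ∈ H}. -/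
theorem aux_M {P : Type*} (H : AddSubmonoid (P →₀ ℕ)) 
    (p : P) (hq : pIdeal H p ∈ XH H) (a b : P →₀ ℕ) (ha : a ∈ H) (hb : b ∈ H)
    (hbp : 0 < b p) : ∃ n : ℕ, ∃ s ∈ H, s p = 0 ∧ a ≤ n • b + s := by
  by_contra hcon
  obtain ⟨-, -, hmin⟩ := hq
  let Q : Set (P →₀ ℕ) := {x | x ∈ H ∧ ¬ ∃ n : ℕ, ∃ s ∈ H, s p = 0 ∧ x ≤ n • b + s}
  have h1 : Q = pIdeal H p := by
    apply hmin Q ⟨a, ha, hcon⟩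
    · refine ⟨⟨fun x hx => hx.1, ?_⟩, ?_, ?_⟩
      · rintro x ⟨hx, hx'⟩ h hh
        refine ⟨H.add_mem hx hh, ?_⟩
        rintro ⟨n, s, hs, hsp, hle⟩
        exact hx' ⟨n, s, hs, hsp, le_trans le_self_add hle⟩
      · intro h
        have h0 : (0 : P →₀ ℕ) ∈ Q := by rw [h]; exact H.zero_mem
        exact h0.2 ⟨0, 0, H.zero_mem, rfl, by simp⟩
      · intro x hx y hy hxy
        by_contra hno
        rw [not_or] at hno
        have hx1 : ∃ n : ℕ, ∃ s ∈ H, s p = 0 ∧ x ≤ n • b + s := by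
          by_contra h; exact hno.1 ⟨hx, h⟩
        have hy1 : ∃ n : ℕ, ∃ s ∈ H, s p = 0 ∧ y ≤ n • b + s := by
          by_contra h; exact hno.2 ⟨hy, h⟩
        obtain ⟨n, s, hs, hsp, hle⟩ := hx1
        obtain ⟨m, r, hr, hrp, hle'⟩ := hy1
        refine hxy.2 ⟨n + m, s + r, H.add_mem hs hr, by simp [hsp, hrp], ?_⟩
        calc x + y ≤ (n • b + s) + (m • b + r) := add_le_add hle hle'
          _ = _ := by rw [add_smul]; abel
    · rintro x ⟨hx, hx'⟩
      refine ⟨hx, ?_⟩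
      by_contra h
      exact hx' ⟨0, x, hx, by omega, by simp⟩
  have h2 : b ∈ Q := by rw [h1]; exact ⟨hb, hbp⟩
  exact h2.2 ⟨1, 0, H.zero_mem, rfl, by simp⟩

theorem aux_L {P : Type*} (H : AddSubmonoid (P →₀ ℕ)) (p : P) (u v : P →₀ ℕ)
    (h : ∀ t, (∀ s ∈ H, s p = 0 → s t = 0) → v t ≤ u t) :
    ∃ s ∈ H, s p = 0 ∧ v ≤ u + s := by
  classical
  have key : ∀ t : P, ∃ s ∈ H, s p = 0 ∧ v t ≤ u t + s t := by
    intro t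
    by_cases ht : ∀ s ∈ H, s p = 0 → s t = 0
    · exact ⟨0, H.zero_mem, rfl, by simpa using h t ht⟩
    · push Not at ht
      obtain ⟨s, hs, hsp, hst⟩ := ht
      refine ⟨v t • s, H.nsmul_mem hs _, by simp [hsp], ?_⟩
      have : 1 ≤ s t := by omega
      simp only [Finsupp.smul_apply, smul_eq_mul]
      nlinarith
  choose f hf hfp hfle using key
  refine ⟨∑ t ∈ v.support, f t, H.sum_mem fun t _ => hf t, ?_, ?_⟩
  · rw [Finsupp.finsetSum_apply]; exact Finset.sum_eq_zero fun t _ => hfp t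
  · intro t
    by_cases ht : t ∈ v.support
    · rw [Finsupp.add_apply, Finsupp.finsetSum_apply]
      have := Finset.single_le_sum (f := fun i => f i t) (fun i _ => Nat.zero_le _) ht
      have := hfle t
      omega
    · simp only [Finsupp.mem_support_iff, not_not] at ht
      simp [ht]

theorem aux_R {P : Type*} (H : AddSubmonoid (P →₀ ℕ)) (hdiv : IsDivHomF H)
    (p : P) (hq : pIdeal H p ∈ XH H) (a b : P →₀ ℕ) (ha : a ∈ H) (hb : b ∈ H)
    (hbp : 0 < b p) (t : P) (ht : ∀ s ∈ H, s p = 0 → s t = 0) :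
    a p * b t ≤ a t * b p := by
  classical
  obtain ⟨t0, ht0, hmin⟩ := Finset.exists_min_image
    (b.support.filter fun t => ∀ s ∈ H, s p = 0 → s t = 0) (fun t => (a t : ℚ) / b t)
    ⟨p, by simp [hbp.ne']⟩
  simp only [Finset.mem_filter, Finsupp.mem_support_iff] at ht0 hmin
  have hb0 : 0 < b t0 := Nat.pos_of_ne_zero ht0.1
  have hm : ∀ t, (∀ s ∈ H, s p = 0 → s t = 0) → a t0 * b t ≤ b t0 * a t := by
    intro t ht
    by_cases hbt : b t = 0
    · simp [hbt]
    · have h := hmin t ⟨hbt, ht⟩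
      have hbt' : 0 < b t := Nat.pos_of_ne_zero hbt
      rw [div_le_div_iff₀ (by exact_mod_cast hb0) (by exact_mod_cast hbt')] at h
      rw [mul_comm (b t0)]
      exact_mod_cast h
  obtain ⟨s, hs, hsp, hle⟩ := aux_L H p (b t0 • a) (a t0 • b) (by simpa using hm)
  have hc := hdiv _ (H.nsmul_mem hb (a t0)) _ (H.add_mem (H.nsmul_mem ha (b t0)) hs) hle
  set c := b t0 • a + s - a t0 • b with hcdef
  have hc0 : c t0 = 0 := by
    simp [hcdef, ht0.2 s hs hsp, mul_comm]
  have hcp : c p = 0 := by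
    by_contra hne
    obtain ⟨n, r, hr, hrp, hle'⟩ := aux_M H p hq b c hb hc (Nat.pos_of_ne_zero hne)
    have := hle' t0
    simp [hc0, ht0.2 r hr hrp] at this
    omega
  have hp : b t0 * a p ≤ a t0 * b p := by
    simp [hcdef, hsp] at hcp
    omega
  have h3 := hm t ht
  have : b t0 * (a p * b t) ≤ b t0 * (a t * b p) := by
    calc b t0 * (a p * b t) = (b t0 * a p) * b t := by ring
      _ ≤ (a t0 * b p) * b t := Nat.mul_le_mul_right _ hp
      _ = (a t0 * b t) * b p := by ring
      _ ≤ (b t0 * a t) * b p := Nat.mul_le_mul_right _ h3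
      _ = _ := by ring
  exact Nat.le_of_mul_le_mul_left this hb0

/-- Let `H ↪ F(P)` be a divisor homomorphism and `p ∈ P` with
`pF ∩ H ∈ 𝔛(H)`, and let `e = min {h(p) : h ∈ H, h(p) > 0}`. Then
`{h(p) : h ∈ H} = e·ℕ₀`; in particular `e = gcd {h(p) : h ∈ H}`. -/
theorem valuation_at_prime {P : Type*} (H : AddSubmonoid (P →₀ ℕ)) (hdiv : IsDivHomF H)
    (p : P) (hq : pIdeal H p ∈ XH H) (e : ℕ)
    (he : e = sInf {n : ℕ | 0 < n ∧ ∃ h ∈ H, (h : P →₀ ℕ) p = n}) :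
    ({n : ℕ | ∃ h ∈ H, (h : P →₀ ℕ) p = n} = {m : ℕ | ∃ n : ℕ, m = e * n}) ∧
    (∀ h ∈ H, e ∣ (h : P →₀ ℕ) p) ∧
    (∀ d : ℕ, (∀ h ∈ H, d ∣ (h : P →₀ ℕ) p) → d ∣ e) := by
  have hne : {n : ℕ | 0 < n ∧ ∃ h ∈ H, (h : P →₀ ℕ) p = n}.Nonempty := by
    obtain ⟨x, hx, hxp⟩ := hq.1
    exact ⟨x p, hxp, x, hx, rfl⟩
  have hmem := Nat.sInf_mem hne
  rw [← he] at hmem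
  obtain ⟨hepos, b, hb, hbe⟩ := hmem
  have hdvd : ∀ h ∈ H, e ∣ (h : P →₀ ℕ) p := by
    intro a ha
    have hdm := Nat.div_add_mod (a p) e
    have hlt := Nat.mod_lt (a p) hepos
    obtain ⟨s, hs, hsp, hle⟩ := aux_L H p a ((a p / e) • b) (by
      intro t ht
      have h1 := aux_R H hdiv p hq a b ha hb (by omega) t ht
      rw [hbe] at h1
      simp only [Finsupp.smul_apply, smul_eq_mul]
      have h2 : (e * (a p / e)) * b t ≤ a p * b t := Nat.mul_le_mul_right _ (by omega)
      have h3 : e * (a p / e * b t) ≤ e * a t := by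
        rw [← mul_assoc, mul_comm e (a t)]; exact h2.trans h1
      exact Nat.le_of_mul_le_mul_left h3 hepos)
    have hc := hdiv _ (H.nsmul_mem hb (a p / e)) _ (H.add_mem ha hs) hle
    have hcp : (a + s - (a p / e) • b) p = a p % e := by
      simp only [Finsupp.tsub_apply, Finsupp.add_apply, Finsupp.smul_apply, smul_eq_mul, hsp, hbe]
      rw [mul_comm (a p / e)]
      omega
    by_contra hnd
    have hpos : 0 < a p % e := Nat.pos_of_ne_zero fun h => hnd (Nat.dvd_of_mod_eq_zero h)
    have : e ≤ a p % e := by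
      exact he.le.trans (Nat.sInf_le ⟨hpos, _, hc, hcp⟩)
    omega
  refine ⟨?_, hdvd, fun d hd => hbe ▸ hd b hb⟩
  ext m
  constructor
  · rintro ⟨h, hh, rfl⟩
    exact hdvd h hh
  · rintro ⟨n, rfl⟩
    exact ⟨n • b, H.nsmul_mem hb n, by simp [hbe, mul_comm]⟩
end

section
/- Let P be a set, F = F(P) the free abelian monoid over P, and H ⊆ F a submonoid such that the inclusion H ↪ F is a divisor homomorphism. Assume a function f: 𝔛(H) → P is given with q = f(q)F ∩ H for every q ∈ 𝔛(H), and for q ∈ 𝔛(H) set e(q) = min{h(f(q)) : h ∈ H, h(f(q)) > 0}. Then: (a) e(q) divides h(f(q)) for every h ∈ H and every q ∈ 𝔛(H); and (b) the map ∂: H → F(𝔛(H)) defined by ∂(h)(q) = h(f(q))/e(q) is a monoid homomorphism which is a divisor theory for H, i.e., for a, b ∈ H, ∂(a) ≤ ∂(b) pointwise implies b − a ∈ H, and for every q ∈ 𝔛(H) there exists a finite nonempty set X ⊆ H such that the pointwise infimum of ∂(X) equals the indicator function of q. -/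
open scoped Classical

theorem aux_descent {P : Type*} (Q : Set (P →₀ ℕ)) (hQ : Q.Nonempty) (a b : P →₀ ℕ) (t : P)
    (hab : b t < a t) (h : ∀ g ∈ Q, ∃ g' ∈ Q, g' + a = g + b) : False := by
  have key : ∀ n : ℕ, ∀ g ∈ Q, g t = n → False := by
    intro n
    induction n using Nat.strong_induction_on with
    | _ n ih =>
      intro g hg hn
      obtain ⟨g', hg', e⟩ := h g hg
      have e1 := DFunLike.congr_fun e t
      simp only [Finsupp.add_apply] at e1
      exact ih (g' t) (by omega) g' hg' rfl
  obtain ⟨g, hg⟩ := hQ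
  exact key _ g hg rfl

theorem pIdeal_prime {P : Type*} (H : AddSubmonoid (P →₀ ℕ)) (t : P) :
    IsPrimeSIdeal H (pIdeal H t) := by
  refine ⟨⟨fun x hx => hx.1, fun x hx h hh => ⟨H.add_mem hx.1 hh, ?_⟩⟩, ?_, ?_⟩
  · have := hx.2
    simp only [Finsupp.add_apply]; omega
  · intro hE
    have h0 : (0 : P →₀ ℕ) ∈ pIdeal H t := by rw [hE]; exact H.zero_mem
    have := h0.2
    simp at this
  · intro x hx y hy hxy
    have h2 := hxy.2
    simp only [Finsupp.add_apply] at h2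
    by_cases h : 1 ≤ x t
    · exact Or.inl ⟨hx, h⟩
    · exact Or.inr ⟨hy, by omega⟩

theorem aux_local {P : Type*} (H : AddSubmonoid (P →₀ ℕ)) (s : P) (hs : pIdeal H s ∈ XH H)
    (a b : P →₀ ℕ) (ha : a ∈ H)
    (hab : ∀ t, pIdeal H t = pIdeal H s → a t ≤ b t) :
    ∃ u ∈ H, u s = 0 ∧ a ≤ b + u := by
  have key : ∀ t, ∃ u ∈ H, u s = 0 ∧ a t ≤ b t + u t := by
    intro t
    by_cases h0 : a t = 0
    · exact ⟨0, H.zero_mem, rfl, by omega⟩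
    by_cases h1 : pIdeal H t = pIdeal H s
    · exact ⟨0, H.zero_mem, rfl, by simpa using hab t h1⟩
    have h2 : ¬ pIdeal H t ⊆ pIdeal H s := fun hsub =>
      h1 (hs.2.2 _ ⟨a, ha, by omega⟩ (pIdeal_prime H t) hsub)
    obtain ⟨u, hu, hu'⟩ := Set.not_subset.1 h2
    have hus : u s = 0 := by
      by_contra hne
      exact hu' ⟨hu.1, by omega⟩
    refine ⟨a t • u, H.nsmul_mem hu.1 _, by simp [hus], ?_⟩
    have := hu.2
    simp only [Finsupp.smul_apply, smul_eq_mul]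
    nlinarith
  choose u hu hus hut using key
  refine ⟨∑ t ∈ a.support, u t, H.sum_mem fun t _ => hu t, ?_, ?_⟩
  · simp [Finsupp.finsetSum_apply, hus]
  · intro t
    by_cases h0 : a t = 0
    · simp [h0]
    have hle : u t t ≤ ∑ i ∈ a.support, u i t :=
      Finset.single_le_sum (f := fun i => u i t) (fun _ _ => Nat.zero_le _)
        (Finsupp.mem_support_iff.2 h0)
    have := hut t
    simp only [Finsupp.add_apply, Finsupp.finsetSum_apply]
    omega

theorem pIdeal_zero {P : Type*} (H : AddSubmonoid (P →₀ ℕ)) (s t : P)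
    (h : pIdeal H t = pIdeal H s) (k : P →₀ ℕ) (hk : k ∈ H) (hks : k s = 0) : k t = 0 := by
  by_contra hne
  have : k ∈ pIdeal H s := h ▸ ⟨hk, by omega⟩
  have := this.2
  omega

theorem aux_prop {P : Type*} (H : AddSubmonoid (P →₀ ℕ)) (hdiv : IsDivHomF H)
    (s : P) (hs : pIdeal H s ∈ XH H)
    (h g : P →₀ ℕ) (hh : h ∈ H) (hg : g ∈ H) (t : P) (ht : pIdeal H t = pIdeal H s) :
    h t * g s = h s * g t := by
  by_cases hg0 : g s = 0
  · simp [hg0, pIdeal_zero H s t ht g hg hg0]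
  -- choose the minimizer of the ratio
  let T := g.support.filter (fun t => pIdeal H t = pIdeal H s)
  have hT : T.Nonempty := ⟨s, by simp [T, hg0]⟩
  obtain ⟨r, hr, hmin⟩ := Finset.exists_min_image T (fun t => (h t : ℚ) / g t) hT
  simp only [T, Finset.mem_filter, Finsupp.mem_support_iff] at hr
  have hmin' : ∀ t, pIdeal H t = pIdeal H s → (h r • g) t ≤ (g r • h) t := by
    intro t ht
    simp only [Finsupp.smul_apply, smul_eq_mul]
    by_cases hgt : g t = 0
    · simp [hgt]
    have := hmin t (by simp [T, hgt, ht])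
    have h1 : (0 : ℚ) < g t := by exact_mod_cast Nat.pos_of_ne_zero hgt
    have h2 : (0 : ℚ) < g r := by exact_mod_cast Nat.pos_of_ne_zero hr.1
    rw [div_le_div_iff₀ h2 h1] at this
    have h3 : h r * g t ≤ h t * g r := by exact_mod_cast this
    linarith
  obtain ⟨u, hu, hus, hle⟩ := aux_local H s hs (h r • g) (g r • h) (H.nsmul_mem hg _) hmin'
  have hk := hdiv _ (H.nsmul_mem hg (h r)) _ (H.add_mem (H.nsmul_mem hh (g r)) hu) hle
  set k := g r • h + u - h r • g with hkdef
  have hkr : k r = 0 := by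
    have := pIdeal_zero H s r hr.2 u hu hus
    simp only [hkdef, Finsupp.tsub_apply, Finsupp.add_apply, Finsupp.smul_apply, smul_eq_mul, this]
    rw [mul_comm]; simp
  have hall : ∀ t, pIdeal H t = pIdeal H s → g r * h t = h r * g t := by
    intro t ht
    have h1 := pIdeal_zero H r t (ht.trans hr.2.symm) k hk hkr
    have h2 := pIdeal_zero H s t ht u hu hus
    have h3 := hmin' t ht
    simp only [hkdef, Finsupp.tsub_apply, Finsupp.add_apply, Finsupp.smul_apply, smul_eq_mul,
      h2] at h1 h3
    omega
  have e1 := hall t ht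
  have e2 := hall s rfl
  have hpos : 0 < g r := Nat.pos_of_ne_zero hr.1
  apply Nat.eq_of_mul_eq_mul_left hpos
  calc g r * (h t * g s) = (g r * h t) * g s := by ring
    _ = (h r * g s) * g t := by rw [e1]; ring
    _ = g r * (h s * g t) := by rw [← e2]; ring

theorem aux_exists {P : Type*} (H : AddSubmonoid (P →₀ ℕ)) (hdiv : IsDivHomF H)
    (a b : P →₀ ℕ) (ha : a ∈ H) (hb : b ∈ H) (hab : ¬ a ≤ b) :
    ∃ q ∈ XH H, ∀ h ∈ H, a ≤ b + h → h ∈ q := by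
  let Z : Set (P →₀ ℕ) := {z | ∃ a' ∈ H, ∃ b' ∈ H, z = a' - b' ∧ z ≠ 0 ∧
    ∀ h ∈ H, a ≤ b + h → z ≤ h}
  have hZ : Z.Nonempty := by
    refine ⟨a - b, a, ha, b, hb, rfl, ?_, ?_⟩
    · intro h; exact hab (tsub_eq_zero_iff_le.1 h)
    · intro h _ hle; exact tsub_le_iff_left.2 hle
  obtain ⟨z, hz, hmin⟩ := WellFounded.has_min (wellFounded_lt (α := P →₀ ℕ)) Z hZ
  obtain ⟨a0, ha0, b0, hb0, hzE, hz0, hzI⟩ := hz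
  have hmem : ∀ h, z ≤ h ↔ a0 ≤ b0 + h := fun h => by rw [hzE, tsub_le_iff_left]
  obtain ⟨t, ht⟩ : ∃ t, b0 t < a0 t := by
    by_contra hcon
    push Not at hcon
    exact hz0 (by rw [hzE]; exact tsub_eq_zero_iff_le.2 hcon)
  let q : Set (P →₀ ℕ) := {h | h ∈ H ∧ z ≤ h}
  have hqne : q.Nonempty := ⟨a, ha, hzI a ha (le_add_of_nonneg_left (zero_le))⟩
  have hq : IsPrimeSIdeal H q := by
    refine ⟨⟨fun x hx => hx.1, fun x hx h hh => ⟨H.add_mem hx.1 hh,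
      hx.2.trans (le_add_of_nonneg_right (zero_le))⟩⟩, ?_, ?_⟩
    · intro hE
      have h0 : (0 : P →₀ ℕ) ∈ q := by rw [hE]; exact H.zero_mem
      exact hz0 (le_antisymm h0.2 (zero_le))
    · intro x hx y hy hxy
      by_contra hcon
      push Not at hcon
      obtain ⟨h1, h2⟩ := hcon
      have hzx : ¬ z ≤ x := fun h => h1 ⟨hx, h⟩
      have hzy : ¬ z ≤ y := fun h => h2 ⟨hy, h⟩
      have hz'le : a0 - (b0 + x) ≤ z := by
        rw [hzE]; exact tsub_le_tsub_left (le_add_of_nonneg_right (zero_le)) _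
      have hz' : a0 - (b0 + x) ∈ Z := by
        refine ⟨a0, ha0, b0 + x, H.add_mem hb0 hx, rfl, ?_, ?_⟩
        · intro h; exact hzx ((hmem x).2 (tsub_eq_zero_iff_le.1 h))
        · intro h hh hle; exact hz'le.trans (hzI h hh hle)
      have hEq : a0 - (b0 + x) = z := by
        by_contra hne
        exact hmin _ hz' (lt_of_le_of_ne hz'le hne)
      apply hzy
      rw [← hEq, tsub_le_iff_left, add_assoc]
      exact (hmem _).1 hxy.2
  have hshift : ∀ g ∈ q, ∃ g' ∈ H, g' + a0 = g + b0 := by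
    intro g hg
    have hle := (hmem g).1 hg.2
    exact ⟨b0 + g - a0, hdiv _ ha0 _ (H.add_mem hb0 hg.1) hle, by
      rw [tsub_add_cancel_of_le hle, add_comm]⟩
  obtain ⟨g, hg, g', hg', hgg, hg'q⟩ : ∃ g ∈ q, ∃ g' ∈ H, g' + a0 = g + b0 ∧ g' ∉ q := by
    by_contra hcon
    push Not at hcon
    refine aux_descent q hqne a0 b0 t ht fun g hg => ?_
    obtain ⟨g', hg', e⟩ := hshift g hg
    exact ⟨g', hcon g hg g' hg' e, e⟩
  refine ⟨q, ⟨hqne, hq, ?_⟩, fun h hh hle => ⟨hh, hzI h hh hle⟩⟩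
  intro p hpne hp hpq
  have hswap : ∀ h h', h' + a0 = h + b0 → h + g' = g + h' := by
    intro h h' e
    ext i
    have e1 := DFunLike.congr_fun e i
    have e2 := DFunLike.congr_fun hgg i
    simp only [Finsupp.add_apply] at *
    omega
  by_cases hgp : g ∈ p
  · refine Set.Subset.antisymm hpq fun h hh => ?_
    obtain ⟨h', hh', e⟩ := hshift h hh
    have : h + g' ∈ p := by rw [hswap h h' e]; exact hp.1.2 _ hgp _ hh'
    rcases hp.2.2 h hh.1 g' hg' this with h1 | h1
    · exact h1
    · exact absurd (hpq h1) hg'q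
  · exfalso
    refine aux_descent p hpne a0 b0 t ht fun h hh => ?_
    obtain ⟨h', hh', e⟩ := hshift h (hpq hh)
    refine ⟨h', ?_, e⟩
    have : g + h' ∈ p := by rw [← hswap h h' e]; exact hp.1.2 _ hh _ hg'
    rcases hp.2.2 g hg.1 h' hh' this with h1 | h1
    · exact absurd h1 hgp
    · exact h1

/-- Given `f : 𝔛(H) → P` with `q = f(q)F ∩ H` and
`e(q) = min {h(f(q)) : h ∈ H, h(f(q)) > 0}`, the quantities `e(q)` divide all values
`h(f(q))`, and the map `∂ : H → F(𝔛(H))`, `∂(h)(q) = h(f(q))/e(q)`, is a finitely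
supported additive monoid homomorphism which is a divisor theory for `H`. -/
theorem canonical_divisor_theory {P : Type*} (H : AddSubmonoid (P →₀ ℕ))
    (hdiv : IsDivHomF H) (f : ↥(XH H) → P)
    (hf : ∀ q : ↥(XH H), (q : Set (P →₀ ℕ)) = pIdeal H (f q))
    (e : ↥(XH H) → ℕ)
    (he : ∀ q : ↥(XH H), e q = sInf {n : ℕ | 0 < n ∧ ∃ h ∈ H, (h : P →₀ ℕ) (f q) = n}) :
    -- (a) `e(q)` divides `h(f(q))`
    (∀ q : ↥(XH H), ∀ h ∈ H, e q ∣ (h : P →₀ ℕ) (f q)) ∧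
    -- `∂(h)` is finitely supported
    (∀ h ∈ H, {q : ↥(XH H) | (h : P →₀ ℕ) (f q) / e q ≠ 0}.Finite) ∧
    -- `∂` is additive
    (∀ a ∈ H, ∀ b ∈ H, ∀ q : ↥(XH H),
      (a + b) (f q) / e q = a (f q) / e q + b (f q) / e q) ∧
    -- `∂` is a divisor homomorphism
    (∀ a ∈ H, ∀ b ∈ H,
      (∀ q : ↥(XH H), a (f q) / e q ≤ b (f q) / e q) → b - a ∈ H) ∧
    -- every `q₀ ∈ 𝔛(H)` is the infimum of finitely many images from `H`
    (∀ q0 : ↥(XH H), ∃ (X : Finset (P →₀ ℕ)) (hX : X.Nonempty),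
      (X : Set (P →₀ ℕ)) ⊆ (H : Set (P →₀ ℕ)) ∧
      ∀ q : ↥(XH H), X.inf' hX (fun h => h (f q) / e q) = if q = q0 then 1 else 0) := by
  have hX : ∀ q : ↥(XH H), pIdeal H (f q) ∈ XH H := fun q => hf q ▸ q.2
  have hepos : ∀ q : ↥(XH H), 0 < e q ∧ ∃ h ∈ H, (h : P →₀ ℕ) (f q) = e q := by
    intro q
    have hne : {n : ℕ | 0 < n ∧ ∃ h ∈ H, (h : P →₀ ℕ) (f q) = n}.Nonempty := by
      obtain ⟨h, hh⟩ := (hX q).1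
      exact ⟨h (f q), hh.2, h, hh.1, rfl⟩
    have := Nat.sInf_mem hne
    rw [← he q] at this
    exact this
  have hemin : ∀ q : ↥(XH H), ∀ h ∈ H, 0 < (h : P →₀ ℕ) (f q) → e q ≤ h (f q) := by
    intro q h hh hpos
    rw [he q]
    exact Nat.sInf_le ⟨hpos, h, hh, rfl⟩
  have hdvd : ∀ q : ↥(XH H), ∀ h ∈ H, e q ∣ (h : P →₀ ℕ) (f q) := by
    intro q h hh
    obtain ⟨hp, g, hg, hge⟩ := hepos q
    set n := h (f q) / e q with hn
    have hdm : e q * n + h (f q) % e q = h (f q) := Nat.div_add_mod _ _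
    have hle : ∀ t, pIdeal H t = pIdeal H (f q) → (n • g) t ≤ h t := by
      intro t ht
      have h1 := aux_prop H hdiv (f q) (hX q) h g hh hg t ht
      rw [hge] at h1
      simp only [Finsupp.smul_apply, smul_eq_mul]
      apply Nat.le_of_mul_le_mul_right _ hp
      rw [h1]
      calc n * g t * e q = (e q * n) * g t := by ring
        _ ≤ h (f q) * g t := Nat.mul_le_mul_right _ (by omega)
    obtain ⟨u, hu, hus, hle'⟩ := aux_local H (f q) (hX q) (n • g) h (H.nsmul_mem hg _) hle
    have hk := hdiv _ (H.nsmul_mem hg n) _ (H.add_mem hh hu) hle'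
    have hkv : (h + u - n • g) (f q) = h (f q) % e q := by
      simp only [Finsupp.tsub_apply, Finsupp.add_apply, Finsupp.smul_apply, smul_eq_mul, hus, hge]
      rw [mul_comm n]; omega
    by_contra hnd
    have hpos : 0 < h (f q) % e q := Nat.pos_of_ne_zero fun h0 => hnd (Nat.dvd_of_mod_eq_zero h0)
    have h2 := hemin q _ hk (by rw [hkv]; exact hpos)
    rw [hkv] at h2
    have := Nat.mod_lt (h (f q)) hp
    omega
  have hfin : ∀ h ∈ H, {q : ↥(XH H) | (h : P →₀ ℕ) (f q) / e q ≠ 0}.Finite := by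
    intro h _
    have hinj : Function.Injective f := by
      intro q q' hqq
      apply Subtype.ext
      rw [hf q, hf q', hqq]
    refine Set.Finite.subset (Set.Finite.preimage hinj.injOn h.support.finite_toSet) ?_
    intro q hq
    simp only [Set.mem_preimage, Finset.mem_coe, Finsupp.mem_support_iff]
    intro h0
    apply hq
    simp [h0]
  refine ⟨hdvd, hfin, ?_, ?_, ?_⟩
  · intro a ha b hb q
    rw [Finsupp.add_apply]
    exact Nat.add_div_of_dvd_right (hdvd q a ha)
  · intro a ha b hb hle
    by_cases hab : a ≤ b
    · exact hdiv a ha b hb hab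
    exfalso
    obtain ⟨q', hq', hI⟩ := aux_exists H hdiv a b ha hb hab
    obtain ⟨q, rfl⟩ : ∃ q : ↥(XH H), (q : Set (P →₀ ℕ)) = q' := ⟨⟨q', hq'⟩, rfl⟩
    obtain ⟨hp, g, hg, hge⟩ := hepos q
    have hq : a (f q) ≤ b (f q) := by
      rw [← Nat.div_mul_cancel (hdvd q a ha), ← Nat.div_mul_cancel (hdvd q b hb)]
      exact Nat.mul_le_mul_right _ (hle q)
    have hall : ∀ t, pIdeal H t = pIdeal H (f q) → a t ≤ b t := by
      intro t ht
      have h1 := aux_prop H hdiv (f q) (hX q) a g ha hg t ht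
      have h2 := aux_prop H hdiv (f q) (hX q) b g hb hg t ht
      rw [hge] at h1 h2
      apply Nat.le_of_mul_le_mul_right _ hp
      rw [h1, h2]
      exact Nat.mul_le_mul_right _ hq
    obtain ⟨u, hu, hus, hle'⟩ := aux_local H (f q) (hX q) a b ha hall
    have := hI u hu hle'
    rw [hf q] at this
    have := this.2
    omega
  · intro q0
    obtain ⟨hp, g, hg, hge⟩ := hepos q0
    have hsep : ∀ q : ↥(XH H), ∃ w ∈ H, 0 < (w : P →₀ ℕ) (f q0) ∧ (q ≠ q0 → w (f q) = 0) := by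
      intro q
      by_cases hqq : q = q0
      · exact ⟨g, hg, by omega, fun h => absurd hqq h⟩
      have : ¬ (q0 : Set (P →₀ ℕ)) ⊆ q := fun hsub =>
        hqq (Subtype.ext (q.2.2.2 _ q0.2.1 q0.2.2.1 hsub).symm)
      obtain ⟨w, hw, hw'⟩ := Set.not_subset.1 this
      rw [hf q0] at hw
      refine ⟨w, hw.1, hw.2, fun _ => ?_⟩
      by_contra hne
      exact hw' (by rw [hf q]; exact ⟨hw.1, by omega⟩)
    choose w hw hw0 hwq using hsep
    have hXne : (insert g ((hfin g hg).toFinset.image w)).Nonempty := Finset.insert_nonempty _ _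
    refine ⟨insert g ((hfin g hg).toFinset.image w), hXne, ?_, ?_⟩
    · intro x hx
      simp only [Finset.coe_insert, Finset.coe_image, Set.mem_insert_iff, Set.mem_image] at hx
      rcases hx with rfl | ⟨q, _, rfl⟩
      · exact hg
      · exact hw q
    · intro q
      split_ifs with hqq
      · subst hqq
        apply le_antisymm
        · refine (Finset.inf'_le _ (Finset.mem_insert_self _ _)).trans ?_
          rw [hge, Nat.div_self hp]
        · refine Finset.le_inf' _ _ fun x hx => ?_
          have hx' : x ∈ H ∧ 0 < x (f q) := by
            simp only [Finset.mem_insert, Finset.mem_image] at hx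
            rcases hx with rfl | ⟨q', _, rfl⟩
            · exact ⟨hg, by omega⟩
            · exact ⟨hw q', hw0 q'⟩
          exact Nat.div_pos (hemin q x hx'.1 hx'.2) hp
      · apply Nat.eq_zero_of_le_zero
        by_cases h0 : g (f q) / e q = 0
        · exact (Finset.inf'_le _ (Finset.mem_insert_self _ _)).trans h0.le
        · refine (Finset.inf'_le (b := w q) _ ?_).trans ?_
          · refine Finset.mem_insert_of_mem (Finset.mem_image_of_mem _ ?_)
            simpa using h0
          · simp [hwq q hqq]
end

section
/- Let P be a set, F = F(P) the free abelian monoid over P, and H ⊆ F a submonoid such that the inclusion H ↪ F is a divisor homomorphism, with class group G = q(F)/q(H). Assume a function f: 𝔛(H) → P is given with q = f(q)F ∩ H for every q ∈ 𝔛(H), set e(q) = min{h(f(q)) : h ∈ H, h(f(q)) > 0}, let ∂: H → F(𝔛(H)) be defined by ∂(h)(q) = h(f(q))/e(q), and let C(∂) be the quotient of the group of finitely supported functions 𝔛(H) → ℤ by the subgroup generated by ∂(H). Let Ḡ = {[x] : x ∈ q(F) with e(q) dividing x(f(q)) for all q ∈ 𝔛(H)}, a subgroup of G. Then the map x ↦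 (q ↦ x(f(q))/e(q)) induces a well-defined surjective group homomorphism δ: Ḡ → C(∂); in particular C(∂) is isomorphic to a subquotient of G and r(C(∂)) ≤ r(G). -/
/-- The image set `∂(H)` inside the free abelian group over `𝔛(H)`. -/
def delSet {P : Type*} (H : AddSubmonoid (P →₀ ℕ)) (f : ↥(XH H) → P) (e : ↥(XH H) → ℕ) :
    Set (↥(XH H) →₀ ℤ) :=
  {y | ∃ h ∈ H, ∀ q : ↥(XH H), y q = ((h : P →₀ ℕ) (f q) / e q : ℕ)}

/-- The class group `C(∂)` of the divisor theory `∂`: the quotient of the free abelian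
group over `𝔛(H)` by the subgroup generated by `∂(H)`. -/
abbrev Cdel {P : Type*} (H : AddSubmonoid (P →₀ ℕ)) (f : ↥(XH H) → P) (e : ↥(XH H) → ℕ) :
    Type _ :=
  (↥(XH H) →₀ ℤ) ⧸ AddSubgroup.closure (delSet H f e)

/-- The subgroup of `q(F)` of elements `x` with `e(q) ∣ x(f(q))` for all `q ∈ 𝔛(H)`. -/
noncomputable def divSub {P : Type*} (H : AddSubmonoid (P →₀ ℕ)) (f : ↥(XH H) → P) (e : ↥(XH H) → ℕ) :
    AddSubgroup (P →₀ ℤ) where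
  carrier := {x | ∀ q : ↥(XH H), (e q : ℤ) ∣ x (f q)}
  zero_mem' := fun q => by simp
  add_mem' := by
    intro x y hx hy q
    rw [Finsupp.add_apply]
    exact dvd_add (hx q) (hy q)
  neg_mem' := by
    intro x hx q
    rw [Finsupp.neg_apply]
    exact dvd_neg.mpr (hx q)

/-- The subgroup `Ḡ = {[x] : x ∈ q(F), e(q) ∣ x(f(q)) for all q} ⊆ G`. -/
noncomputable def GbarSub {P : Type*} (H : AddSubmonoid (P →₀ ℕ)) (f : ↥(XH H) → P)
    (e : ↥(XH H) → ℕ) : AddSubgroup (ClassGrp H) :=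
  (divSub H f e).map (clsOf H)

/-- The torsion-free rank `r(A) = dim_ℚ (A ⊗ ℚ)` of an abelian group `A`. -/
noncomputable def tfRank (A : Type*) [AddCommGroup A] :=
  Module.rank ℚ (TensorProduct ℤ ℚ A)

theorem aux_prime {P : Type*} (H : AddSubmonoid (P →₀ ℕ)) (p : P) :
    IsPrimeSIdeal H (pIdeal H p) := by
  refine ⟨⟨fun x hx => hx.1, fun x hx h hh => ⟨H.add_mem hx.1 hh, ?_⟩⟩, ?_, ?_⟩
  · have := hx.2
    simp only [Finsupp.add_apply]
    omega
  · intro h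
    have h0 : (0 : P →₀ ℕ) ∈ pIdeal H p := by
      rw [h]; exact H.zero_mem
    have := h0.2
    simp at this
  · intro x hx y hy hxy
    have := hxy.2
    simp only [Finsupp.add_apply] at this
    by_cases h1 : 1 ≤ x p
    · exact Or.inl ⟨hx, h1⟩
    · exact Or.inr ⟨hy, by omega⟩

theorem aux_A {P : Type*} (H : AddSubmonoid (P →₀ ℕ)) (p : P) (hp : pIdeal H p ∈ XH H)
    (T : Finset P) (hT : ∀ t ∈ T, (∃ g ∈ H, 1 ≤ g t) ∧ pIdeal H t ≠ pIdeal H p) :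
    ∃ s ∈ H, s p = 0 ∧ ∀ t ∈ T, 1 ≤ s t := by
  classical
  induction T using Finset.induction_on with
  | empty => exact ⟨0, H.zero_mem, by simp, by simp⟩
  | insert t T ht ih =>
    obtain ⟨s, hs, hs0, hs1⟩ := ih (fun t' h' => hT t' (Finset.mem_insert_of_mem h'))
    obtain ⟨⟨g, hg, hg1⟩, hne⟩ := hT t (Finset.mem_insert_self _ _)
    have : ¬ pIdeal H t ⊆ pIdeal H p := fun hsub =>
      hne (hp.2.2 _ ⟨g, hg, hg1⟩ (aux_prime H t) hsub)
    obtain ⟨u, hu, hup⟩ := Set.not_subset.1 this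
    have hu0 : u p = 0 := by
      by_contra h
      exact hup ⟨hu.1, by omega⟩
    refine ⟨s + u, H.add_mem hs hu.1, by simp [hs0, hu0], ?_⟩
    intro t' ht'
    have := hu.2
    simp only [Finsupp.add_apply]
    rcases Finset.mem_insert.1 ht' with rfl | h
    · omega
    · have := hs1 t' h
      omega

theorem aux_zero {P : Type*} (H : AddSubmonoid (P →₀ ℕ)) (p t : P)
    (h : pIdeal H t = pIdeal H p) (s : P →₀ ℕ) (hs : s ∈ H) (h0 : s p = 0) : s t = 0 := by
  by_contra hne
  have h1 : s ∈ pIdeal H t := ⟨hs, by omega⟩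
  rw [h] at h1
  have := h1.2
  omega

theorem aux_B {P : Type*} (H : AddSubmonoid (P →₀ ℕ)) (hdiv : IsDivHomF H)
    (p : P) (hp : pIdeal H p ∈ XH H)
    (a b : P →₀ ℕ) (ha : a ∈ H) (hb : b ∈ H)
    (hab : ∀ t, pIdeal H t = pIdeal H p → b t ≤ a t) :
    ∃ c ∈ H, ∀ t, pIdeal H t = pIdeal H p → c t + b t = a t := by
  classical
  obtain ⟨s, hs, hs0, hs1⟩ := aux_A H p hp
    (b.support.filter (fun t => pIdeal H t ≠ pIdeal H p)) (by
      intro t ht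
      rw [Finset.mem_filter, Finsupp.mem_support_iff] at ht
      exact ⟨⟨b, hb, by omega⟩, ht.2⟩)
  have hle : b ≤ a + (∑ t ∈ b.support, b t) • s := by
    intro t
    by_cases h : pIdeal H t = pIdeal H p
    · have := hab t h
      simp only [Finsupp.add_apply]
      omega
    · by_cases h0 : b t = 0
      · simp [h0]
      · have hmem : t ∈ b.support := Finsupp.mem_support_iff.2 h0
        have h1 := hs1 t (Finset.mem_filter.2 ⟨hmem, h⟩)
        have h2 : b t ≤ ∑ t ∈ b.support, b t :=
          Finset.single_le_sum (f := fun t => b t) (fun _ _ => Nat.zero_le _) hmem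
        simp only [Finsupp.add_apply, Finsupp.smul_apply, smul_eq_mul]
        nlinarith
  refine ⟨_, hdiv b hb _ (H.add_mem ha (H.nsmul_mem hs _)) hle, ?_⟩
  intro t ht
  have h0 := aux_zero H p t ht s hs hs0
  have := hab t ht
  simp only [Finsupp.tsub_apply, Finsupp.add_apply, Finsupp.smul_apply, h0, smul_zero]
  omega

theorem aux_C {P : Type*} (H : AddSubmonoid (P →₀ ℕ)) (hdiv : IsDivHomF H)
    (p : P) (hp : pIdeal H p ∈ XH H)
    (g h : P →₀ ℕ) (hg : g ∈ H) (hh : h ∈ H) (hgp : 0 < g p) (t : P)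
    (ht : pIdeal H t = pIdeal H p) : h t * g p = h p * g t := by
  classical
  have hpos : ∀ t, pIdeal H t = pIdeal H p → 0 < g t := by
    intro t ht
    have h1 : g ∈ pIdeal H t := by rw [ht]; exact ⟨hg, hgp⟩
    exact h1.2
  obtain ⟨p0, hp0, hmin⟩ := Finset.exists_min_image
    (g.support.filter (fun t => pIdeal H t = pIdeal H p))
    (fun t => (h t : ℚ) / g t) ⟨p, by simp; omega⟩
  rw [Finset.mem_filter] at hp0
  have hg0 := hpos p0 hp0.2
  obtain ⟨c, hc, hct⟩ := aux_B H hdiv p hp (g p0 • h) (h p0 • g) (H.nsmul_mem hh _)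
    (H.nsmul_mem hg _) (by
      intro t ht
      have h1 := hpos t ht
      have h2 := hmin t (Finset.mem_filter.2 ⟨Finsupp.mem_support_iff.2 (by omega), ht⟩)
      rw [div_le_div_iff₀ (by exact_mod_cast hg0) (by exact_mod_cast h1)] at h2
      have h3 : h p0 * g t ≤ h t * g p0 := by exact_mod_cast h2
      simp only [Finsupp.smul_apply, smul_eq_mul]
      linarith)
  have hc0 : c p0 = 0 := by
    have := hct p0 hp0.2
    simp only [Finsupp.smul_apply, smul_eq_mul] at this
    linarith
  have key : ∀ t, pIdeal H t = pIdeal H p → h p0 * g t = g p0 * h t := by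
    intro t ht
    have h1 := hct t ht
    rw [aux_zero H p0 t (ht.trans hp0.2.symm) c hc hc0] at h1
    simpa using h1
  have k1 := key t ht
  have k2 := key p rfl
  apply Nat.eq_of_mul_eq_mul_left hg0
  calc g p0 * (h t * g p) = (g p0 * h t) * g p := by ring
    _ = (h p0 * g p) * g t := by rw [← k1]; ring
    _ = g p0 * (h p * g t) := by rw [k2]; ring

theorem aux_D {P : Type*} (H : AddSubmonoid (P →₀ ℕ)) (hdiv : IsDivHomF H)
    (p : P) (hp : pIdeal H p ∈ XH H)
    (g h : P →₀ ℕ) (hg : g ∈ H) (hh : h ∈ H) (hgp : 0 < g p)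
    (hmin : ∀ c ∈ H, 0 < c p → g p ≤ c p) : g p ∣ h p := by
  have hk : (h p / g p) * g p ≤ h p := Nat.div_mul_le_self _ _
  obtain ⟨c, hc, hct⟩ := aux_B H hdiv p hp h ((h p / g p) • g) hh (H.nsmul_mem hg _) (by
    intro t ht
    have h1 := aux_C H hdiv p hp g h hg hh hgp t ht
    simp only [Finsupp.smul_apply, smul_eq_mul]
    refine Nat.le_of_mul_le_mul_right ?_ hgp
    rw [h1]
    calc _ = ((h p / g p) * g p) * g t := by ring
      _ ≤ _ := Nat.mul_le_mul_right _ hk)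
  have h1 := hct p rfl
  simp only [Finsupp.smul_apply, smul_eq_mul] at h1
  have h2 := Nat.div_add_mod' (h p) (g p)
  have h3 := Nat.mod_lt (h p) hgp
  rcases Nat.eq_zero_or_pos (c p) with h0 | h0
  · exact Dvd.intro_left (h p / g p) (by omega)
  · have := hmin c hc h0
    omega

theorem aux_e {P : Type*} (H : AddSubmonoid (P →₀ ℕ))
    (hdiv : IsDivHomF H) (f : ↥(XH H) → P)
    (hf : ∀ q : ↥(XH H), (q : Set (P →₀ ℕ)) = pIdeal H (f q))
    (e : ↥(XH H) → ℕ)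
    (he : ∀ q : ↥(XH H), e q = sInf {n : ℕ | 0 < n ∧ ∃ h ∈ H, (h : P →₀ ℕ) (f q) = n})
    (q : ↥(XH H)) : 0 < e q ∧ ∀ h ∈ H, e q ∣ h (f q) := by
  have hne : {n : ℕ | 0 < n ∧ ∃ h ∈ H, (h : P →₀ ℕ) (f q) = n}.Nonempty := by
    obtain ⟨x, hx⟩ := q.2.1
    rw [hf q] at hx
    exact ⟨x (f q), hx.2, x, hx.1, rfl⟩
  have hm := Nat.sInf_mem hne
  rw [← he q] at hm
  obtain ⟨h0, g, hg, hge⟩ := hm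
  refine ⟨h0, fun h hh => ?_⟩
  rw [← hge]
  refine aux_D H hdiv (f q) (by rw [← hf q]; exact q.2) g h hg hh (by omega) ?_
  intro c hc hc0
  rw [hge, he q]
  exact Nat.sInf_le ⟨hc0, c, hc, rfl⟩

theorem aux_rank.{u} {A B : Type u} [AddCommGroup A] [AddCommGroup B] (S : AddSubgroup A)
    (d : ↥S →+ B) (hd : Function.Surjective d) :
    tfRank B ≤ tfRank A := by
  have h1 : Function.Surjective (d.toIntLinearMap.baseChange ℚ) :=
    LinearMap.lTensor_surjective ℚ (g := d.toIntLinearMap) hd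
  have h2 : Function.Injective (S.subtype.toIntLinearMap.baseChange ℚ) :=
    Module.Flat.lTensor_preserves_injective_linearMap (M := ℚ) S.subtype.toIntLinearMap
      S.subtype_injective
  have h3 := LinearMap.rank_le_of_surjective _ h1
  have h4 := LinearMap.rank_le_of_injective _ h2
  exact h3.trans h4

/-- The map `x ↦ (q ↦ x(f(q))/e(q))` induces a well-defined surjective
group homomorphism `δ : Ḡ → C(∂)`; in particular `C(∂)` is isomorphic to a subquotient
of `G` and `r(C(∂)) ≤ r(G)`. -/
theorem delta_surjective {P : Type*} (H : AddSubmonoid (P →₀ ℕ))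
    (hdiv : IsDivHomF H) (f : ↥(XH H) → P)
    (hf : ∀ q : ↥(XH H), (q : Set (P →₀ ℕ)) = pIdeal H (f q))
    (e : ↥(XH H) → ℕ)
    (he : ∀ q : ↥(XH H), e q = sInf {n : ℕ | 0 < n ∧ ∃ h ∈ H, (h : P →₀ ℕ) (f q) = n}) :
    (∃ δ : ↥(GbarSub H f e) →+ Cdel H f e,
      Function.Surjective δ ∧
      ∀ (x : P →₀ ℤ) (hx : x ∈ divSub H f e) (y : ↥(XH H) →₀ ℤ),
        (∀ q : ↥(XH H), y q * e q = x (f q)) →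
        δ ⟨clsOf H x, AddSubgroup.mem_map_of_mem (clsOf H) hx⟩ =
          QuotientAddGroup.mk' (AddSubgroup.closure (delSet H f e)) y) ∧
    (∃ (A : AddSubgroup (ClassGrp H)) (B : AddSubgroup ↥A),
      Nonempty (Cdel H f e ≃+ ↥A ⧸ B)) ∧
    tfRank (Cdel H f e) ≤ tfRank (ClassGrp H) := by
  classical
  have hE := aux_e H hdiv f hf e he
  have e0 : ∀ q, (e q : ℤ) ≠ 0 := fun q => by
    have := (hE q).1
    omega
  have finj : Function.Injective f := by
    intro q q' h
    apply Subtype.ext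
    rw [hf q, hf q', h]
  have uniq : ∀ y y' : ↥(XH H) →₀ ℤ, (∀ q, y q * e q = y' q * e q) → y = y' := by
    intro y y' h
    ext q
    exact mul_right_cancel₀ (e0 q) (h q)
  have exY : ∀ x ∈ divSub H f e, ∃ y : ↥(XH H) →₀ ℤ, ∀ q, y q * e q = x (f q) := by
    intro x hx
    refine ⟨Finsupp.onFinset (x.support.preimage f finj.injOn) (fun q => x (f q) / e q) ?_, ?_⟩
    · intro q hq
      rw [Finset.mem_preimage, Finsupp.mem_support_iff]
      intro h
      simp [h] at hq
    · intro q
      exact Int.ediv_mul_cancel (hx q)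
  choose Y hY using exY
  have hker : ∀ x ∈ qHsub H, ∃ y ∈ AddSubgroup.closure (delSet H f e),
      ∀ q, y q * e q = x (f q) := by
    intro x hx
    induction hx using AddSubgroup.closure_induction with
    | mem x hx =>
      obtain ⟨h, hh, rfl⟩ := hx
      have hmem : toIntF h ∈ divSub H f e := by
        intro q
        have := (hE q).2 h hh
        simpa [toIntF] using Int.natCast_dvd_natCast.2 this
      refine ⟨Y _ hmem, AddSubgroup.subset_closure ⟨h, hh, fun q => ?_⟩, hY _ hmem⟩
      apply mul_right_cancel₀ (e0 q)
      rw [hY _ hmem q]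
      have := Nat.div_mul_cancel ((hE q).2 h hh)
      rw [← Nat.cast_mul, this]
      simp [toIntF]
    | zero => exact ⟨0, AddSubgroup.zero_mem _, by simp⟩
    | add x y _ _ hx hy =>
      obtain ⟨u, hu, hu'⟩ := hx
      obtain ⟨v, hv, hv'⟩ := hy
      exact ⟨u + v, AddSubgroup.add_mem _ hu hv, fun q => by simp [add_mul, hu', hv']⟩
    | neg x _ hx =>
      obtain ⟨u, hu, hu'⟩ := hx
      exact ⟨-u, AddSubgroup.neg_mem _ hu, fun q => by simp [hu']⟩
  let D : ↥(divSub H f e) →+ Cdel H f e :=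
    (QuotientAddGroup.mk' (AddSubgroup.closure (delSet H f e))).comp
      (AddMonoidHom.mk' (fun x : ↥(divSub H f e) => Y x.1 x.2) (by
        intro a b
        apply uniq
        intro q
        rw [hY, Finsupp.add_apply, add_mul, hY, hY]
        rfl))
  have hD : ∀ x : ↥(divSub H f e), D x =
      QuotientAddGroup.mk' (AddSubgroup.closure (delSet H f e)) (Y x.1 x.2) := fun _ => rfl
  let φ : ↥(divSub H f e) →+ ↥(GbarSub H f e) := (clsOf H).addSubgroupMap (divSub H f e)
  have hφ : Function.Surjective φ := (clsOf H).addSubgroupMap_surjective (divSub H f e)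
  have hφD : φ.ker ≤ D.ker := by
    intro x hx
    rw [AddMonoidHom.mem_ker] at hx ⊢
    have h1 : clsOf H x.1 = 0 := congrArg Subtype.val hx
    have h2 : x.1 ∈ qHsub H := (QuotientAddGroup.eq_zero_iff _).1 h1
    obtain ⟨y, hy, hyq⟩ := hker _ h2
    have h3 : Y x.1 x.2 = y := uniq _ _ (fun q => by rw [hY, hyq])
    rw [hD, h3]
    exact (QuotientAddGroup.eq_zero_iff _).2 hy
  let δ : ↥(GbarSub H f e) →+ Cdel H f e := φ.liftOfSurjective hφ ⟨D, hφD⟩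
  have hδ : ∀ x, δ (φ x) = D x := fun x =>
    AddMonoidHom.liftOfRightInverse_comp_apply _ _ (Function.rightInverse_surjInv hφ) ⟨D, hφD⟩ x
  have hspec : ∀ (x : P →₀ ℤ) (hx : x ∈ divSub H f e) (y : ↥(XH H) →₀ ℤ),
        (∀ q : ↥(XH H), y q * e q = x (f q)) →
        δ ⟨clsOf H x, AddSubgroup.mem_map_of_mem (clsOf H) hx⟩ =
          QuotientAddGroup.mk' (AddSubgroup.closure (delSet H f e)) y := by
    intro x hx y hy
    have h1 := hδ ⟨x, hx⟩
    rw [hD, uniq (Y x hx) y (fun q => by rw [hY, hy])] at h1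
    exact h1
  have hsurj : Function.Surjective δ := by
    intro z
    obtain ⟨y, rfl⟩ := QuotientAddGroup.mk'_surjective _ z
    let x : P →₀ ℤ := Finsupp.embDomain ⟨f, finj⟩
      (Finsupp.onFinset y.support (fun q => y q * e q) (by
        intro q hq
        rw [Finsupp.mem_support_iff]
        intro h
        simp [h] at hq))
    have hx : ∀ q, y q * e q = x (f q) := by
      intro q
      have := Finsupp.embDomain_apply_self ⟨f, finj⟩
        (Finsupp.onFinset y.support (fun q => y q * e q) (by
        intro q hq
        rw [Finsupp.mem_support_iff]
        intro h
        simp [h] at hq)) q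
      exact this.symm
    exact ⟨_, hspec x (fun q => Dvd.intro_left _ (hx q)) y hx⟩
  refine ⟨⟨δ, hsurj, hspec⟩, ⟨GbarSub H f e, δ.ker,
    ⟨(QuotientAddGroup.quotientKerEquivOfSurjective δ hsurj).symm⟩⟩, ?_⟩
  exact aux_rank (GbarSub H f e) δ hsurj
end
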